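/- arXiv:1311.6232 — 8 statements merged into one kernel-verified Lean document; each statement's English description precedes it below -/
import Mathlib

section
/- Let (A, X, ▷, ◁, ↼, ⇀) be a matched pair of algebras. Then the vector space A × X equipped with the multiplication (a, x) • (b, y) = (ab + a ↼ y + x ▷ b, a ⇀ y + x ◁ b + xy) is an associative (not necessarily unital) K-algebra (the bicrossed product A ⋈ X). -/
/-- A matched pair of (associative, not necessarily unital) `K`-algebras
`(A, X, ▷, ◁, ↼, ⇀)`.  Here `tr x a = x ▷ a`, `tl x a = x ◁ a`,
`lh a x = a ↼ x` and `rh a x = a ⇀ x`. -/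
structure MatchedPair (K A X : Type*) [Field K]
    [NonUnitalRing A] [Module K A] [SMulCommClass K A A] [IsScalarTower K A A]
    [NonUnitalRing X] [Module K X] [SMulCommClass K X X] [IsScalarTower K X X] where
  tr : X →ₗ[K] A →ₗ[K] A
  tl : X →ₗ[K] A →ₗ[K] X
  lh : A →ₗ[K] X →ₗ[K] A
  rh : A →ₗ[K] X →ₗ[K] X
  /-- `(X, ⇀)` is a left `A`-module -/
  rh_mul : ∀ (a b : A) (x : X), rh (a * b) x = rh a (rh b x)
  /-- `(X, ◁)` is a right `A`-module -/
  tl_mul : ∀ (x : X) (a b : A), tl x (a * b) = tl (tl x a) b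
  /-- `(X, ⇀, ◁)` is an `A`-bimodule -/
  rh_tl : ∀ (a : A) (x : X) (b : A), tl (rh a x) b = rh a (tl x b)
  /-- `(A, ▷)` is a left `X`-module -/
  tr_mul : ∀ (x y : X) (a : A), tr (x * y) a = tr x (tr y a)
  /-- `(A, ↼)` is a right `X`-module -/
  lh_mul : ∀ (a : A) (x y : X), lh a (x * y) = lh (lh a x) y
  /-- `(A, ▷, ↼)` is an `X`-bimodule -/
  tr_lh : ∀ (x : X) (a : A) (y : X), lh (tr x a) y = tr x (lh a y)
  /-- (MP1) `a ⇀ (xy) = (a ⇀ x)y + (a ↼ x) ⇀ y` -/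
  mp1 : ∀ (a : A) (x y : X), rh a (x * y) = rh a x * y + rh (lh a x) y
  /-- (MP2) `(ab) ↼ x = a(b ↼ x) + a ↼ (b ⇀ x)` -/
  mp2 : ∀ (a b : A) (x : X), lh (a * b) x = a * lh b x + lh a (rh b x)
  /-- (MP3) `x ▷ (ab) = (x ▷ a)b + (x ◁ a) ▷ b` -/
  mp3 : ∀ (x : X) (a b : A), tr x (a * b) = tr x a * b + tr (tl x a) b
  /-- (MP4) `(xy) ◁ a = x ◁ (y ▷ a) + x(y ◁ a)` -/
  mp4 : ∀ (x y : X) (a : A), tl (x * y) a = tl x (tr y a) + x * tl y a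
  /-- (MP5) `a(x ▷ b) + a ↼ (x ◁ b) = (a ↼ x)b + (a ⇀ x) ▷ b` -/
  mp5 : ∀ (a : A) (x : X) (b : A), a * tr x b + lh a (tl x b) = lh a x * b + tr (rh a x) b
  /-- (MP6) `x ◁ (a ↼ y) + x(a ⇀ y) = (x ▷ a) ⇀ y + (x ◁ a)y` -/
  mp6 : ∀ (x : X) (a : A) (y : X), tl x (lh a y) + x * rh a y = rh (tr x a) y + tl x a * y

/-- The multiplication of the bicrossed product `A ⋈ X`:
`(a, x) • (b, y) = (ab + a ↼ y + x ▷ b, a ⇀ y + x ◁ b + xy)`. -/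
def bicrossedMul {K A X : Type*} [Field K]
    [NonUnitalRing A] [Module K A] [SMulCommClass K A A] [IsScalarTower K A A]
    [NonUnitalRing X] [Module K X] [SMulCommClass K X X] [IsScalarTower K X X]
    (mp : MatchedPair K A X) (p q : A × X) : A × X :=
  (p.1 * q.1 + mp.lh p.1 q.2 + mp.tr p.2 q.1,
    mp.rh p.1 q.2 + mp.tl p.2 q.1 + p.2 * q.2)

/-- For a matched pair of algebras `(A, X, ▷, ◁, ↼, ⇀)`, the vector space
`A × X` with the multiplication `(a, x) • (b, y) = (ab + a ↼ y + x ▷ b, a ⇀ y + x ◁ b + xy)`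
is an associative (not necessarily unital) `K`-algebra: the multiplication is associative
and `K`-bilinear. -/
theorem bicrossedProduct_isAlgebra {K A X : Type*} [Field K]
    [NonUnitalRing A] [Module K A] [SMulCommClass K A A] [IsScalarTower K A A]
    [NonUnitalRing X] [Module K X] [SMulCommClass K X X] [IsScalarTower K X X]
    (mp : MatchedPair K A X) :
    (∀ p q s : A × X,
      bicrossedMul mp (bicrossedMul mp p q) s = bicrossedMul mp p (bicrossedMul mp q s)) ∧
    (∀ p q s : A × X, bicrossedMul mp (p + q) s = bicrossedMul mp p s + bicrossedMul mp q s) ∧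
    (∀ p q s : A × X, bicrossedMul mp p (q + s) = bicrossedMul mp p q + bicrossedMul mp p s) ∧
    (∀ (c : K) (p q : A × X), bicrossedMul mp (c • p) q = c • bicrossedMul mp p q) ∧
    (∀ (c : K) (p q : A × X), bicrossedMul mp p (c • q) = c • bicrossedMul mp p q) := by
  refine ⟨?_, ?_, ?_, ?_, ?_⟩
  · rintro ⟨a, x⟩ ⟨b, y⟩ ⟨c, z⟩
    ext
    · simp only [bicrossedMul, map_add, LinearMap.add_apply, add_mul, mul_add, mul_assoc,
        mp.tr_mul, mp.lh_mul, mp.tr_lh, mp.mp2, mp.mp3]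
      have h := mp.mp5 a y c
      rw [← sub_eq_zero] at h ⊢
      rw [← neg_eq_zero, ← h]
      abel
    · simp only [bicrossedMul, map_add, LinearMap.add_apply, add_mul, mul_add, mul_assoc,
        mp.rh_mul, mp.tl_mul, mp.rh_tl, mp.mp1, mp.mp4]
      have h := mp.mp6 x b z
      rw [← sub_eq_zero] at h ⊢
      rw [← neg_eq_zero, ← h]
      abel
  · intro p q s
    ext <;> simp only [bicrossedMul, Prod.fst_add, Prod.snd_add, map_add, LinearMap.add_apply,
      add_mul] <;> abel
  · intro p q s
    ext <;> simp only [bicrossedMul, Prod.fst_add, Prod.snd_add, map_add, mul_add] <;> abel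
  · intro c p q
    ext <;> simp only [bicrossedMul, Prod.smul_fst, Prod.smul_snd, map_smul,
      LinearMap.smul_apply, smul_mul_assoc, smul_add]
  · intro c p q
    ext <;> simp only [bicrossedMul, Prod.smul_fst, Prod.smul_snd, map_smul,
      mul_smul_comm, smul_add]
end

section
/- Let E be an algebra that factorizes through subalgebras A and X (i.e. E = A + X and A ∩ X = {0}), and define maps by decomposing products in E: for a ∈ A, x ∈ X write xa = x ▷ a + x ◁ a and ax = a ↼ x + a ⇀ x with x ▷ a, a ↼ x ∈ A and x ◁ a, a ⇀ x ∈ X. Then (A, X, ▷, ◁, ↼, ⇀) is a matched pair of algebras. -/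
/-- `X` is an `A`-complement of `E`: `E = A + X` and `A ∩ X = {0}`. -/
def IsComplement {K E : Type*} [Field K]
    [NonUnitalRing E] [Module K E] [SMulCommClass K E E] [IsScalarTower K E E]
    (A X : NonUnitalSubalgebra K E) : Prop :=
  (∀ e : E, ∃ a ∈ A, ∃ x ∈ X, e = a + x) ∧ (∀ e : E, e ∈ A → e ∈ X → e = 0)

/-- `mp` is the canonical matched pair associated with a factorization `E = A + X`:
its four maps are obtained by decomposing products in `E` as
`x a = x ▷ a + x ◁ a` and `a x = a ↼ x + a ⇀ x`. -/
def IsCanonicalMatchedPair {K E : Type*} [Field K]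
    [NonUnitalRing E] [Module K E] [SMulCommClass K E E] [IsScalarTower K E E]
    (A X : NonUnitalSubalgebra K E) (mp : MatchedPair K A X) : Prop :=
  ∀ (x : X) (a : A),
    (x : E) * (a : E) = (mp.tr x a : E) + (mp.tl x a : E) ∧
    (a : E) * (x : E) = (mp.lh a x : E) + (mp.rh a x : E)

namespace IsComplement

variable {K E : Type*} [Field K]
  [NonUnitalRing E] [Module K E] [SMulCommClass K E E] [IsScalarTower K E E]
  {A X : NonUnitalSubalgebra K E}

/-- Components with respect to a factorization are unique. -/
theorem add_inj (h : IsComplement A X) {a b : A} {x y : X}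
    (hab : (a : E) + x = b + y) : a = b ∧ x = y := by
  have hsub : (a : E) - b = y - x := by
    rw [sub_eq_sub_iff_add_eq_add, hab, add_comm]
  have h0 : (a : E) - b = 0 :=
    h.2 _ (sub_mem a.2 b.2) (hsub ▸ sub_mem y.2 x.2)
  refine ⟨Subtype.ext (sub_eq_zero.mp h0), Subtype.ext (sub_eq_zero.mp ?_).symm⟩
  rw [← hsub, h0]

/-- A factorization comes with linear projections onto its two factors. -/
theorem exists_projections (h : IsComplement A X) :
    ∃ (p : E →ₗ[K] A) (q : E →ₗ[K] X), ∀ e : E, e = (p e : E) + q e := by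
  have hex : ∀ e : E, ∃ (a : A) (x : X), e = (a : E) + x := fun e => by
    obtain ⟨a, ha, x, hx, he⟩ := h.1 e
    exact ⟨⟨a, ha⟩, ⟨x, hx⟩, he⟩
  choose p q hpq using hex
  have hadd (e f : E) : p (e + f) = p e + p f ∧ q (e + f) = q e + q f := by
    apply h.add_inj
    rw [← hpq]
    push_cast
    rw [add_add_add_comm, ← hpq, ← hpq]
  have hsmul (c : K) (e : E) : p (c • e) = c • p e ∧ q (c • e) = c • q e := by
    apply h.add_inj
    rw [← hpq]
    push_cast
    rw [← smul_add, ← hpq]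
  exact ⟨⟨⟨p, fun e f => (hadd e f).1⟩, fun c e => (hsmul c e).1⟩,
    ⟨⟨q, fun e f => (hadd e f).2⟩, fun c e => (hsmul c e).2⟩, hpq⟩

/-- Decomposing products in a factorization yields four bilinear maps. -/
theorem exists_bilinear_decomposition (h : IsComplement A X) :
    ∃ (tr : X →ₗ[K] A →ₗ[K] A) (tl : X →ₗ[K] A →ₗ[K] X)
      (lh : A →ₗ[K] X →ₗ[K] A) (rh : A →ₗ[K] X →ₗ[K] X),
      (∀ (x : X) (a : A), (x : E) * a = tr x a + tl x a) ∧
        ∀ (a : A) (x : X), (a : E) * x = lh a x + rh a x := by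
  obtain ⟨p, q, hpq⟩ := h.exists_projections
  let mulXA : X →ₗ[K] A →ₗ[K] E := LinearMap.mk₂ K (fun x a => (x : E) * a)
    (fun x y a => by simp [add_mul]) (fun c x a => by simp [smul_mul_assoc])
    (fun x a b => by simp [mul_add]) (fun c x a => by simp [mul_smul_comm])
  let mulAX : A →ₗ[K] X →ₗ[K] E := LinearMap.mk₂ K (fun a x => (a : E) * x)
    (fun a b x => by simp [add_mul]) (fun c a x => by simp [smul_mul_assoc])
    (fun a x y => by simp [mul_add]) (fun c a x => by simp [mul_smul_comm])
  exact ⟨mulXA.compr₂ p, mulXA.compr₂ q, mulAX.compr₂ p, mulAX.compr₂ q,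
    fun _ _ => hpq _, fun _ _ => hpq _⟩

end IsComplement

/-- If an algebra `E` factorizes through subalgebras `A` and `X`
(`E = A + X`, `A ∩ X = {0}`), then the maps obtained by decomposing products in `E`
(`x a = x ▷ a + x ◁ a`, `a x = a ↼ x + a ⇀ x`, with `x ▷ a, a ↼ x ∈ A` and
`x ◁ a, a ⇀ x ∈ X`) make `(A, X, ▷, ◁, ↼, ⇀)` a matched pair of algebras. -/
theorem canonical_matchedPair_exists {K E : Type*} [Field K]
    [NonUnitalRing E] [Module K E] [SMulCommClass K E E] [IsScalarTower K E E]
    (A X : NonUnitalSubalgebra K E) (h : IsComplement A X) :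
    ∃ mp : MatchedPair K A X, IsCanonicalMatchedPair A X mp := by
  obtain ⟨tr, tl, lh, rh, hxa, hax⟩ := h.exists_bilinear_decomposition
  have hAAX (a b : A) (x : X) :
      lh (a * b) x = a * lh b x + lh a (rh b x) ∧ rh (a * b) x = rh a (rh b x) := by
    apply h.add_inj
    rw [← hax]
    push_cast
    rw [mul_assoc, hax, mul_add, hax, add_assoc]
  have hXAA (x : X) (a b : A) :
      tr x (a * b) = tr x a * b + tr (tl x a) b ∧ tl x (a * b) = tl (tl x a) b := by
    apply h.add_inj
    rw [← hxa]
    push_cast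
    rw [← mul_assoc, hxa, add_mul, hxa, add_assoc]
  have hAXA (a : A) (x : X) (b : A) :
      a * tr x b + lh a (tl x b) = lh a x * b + tr (rh a x) b ∧
        rh a (tl x b) = tl (rh a x) b := by
    apply h.add_inj
    push_cast
    rw [add_assoc, add_assoc, ← hax, ← hxa, ← mul_add, ← add_mul, ← hax, ← hxa, mul_assoc]
  have hXXA (x y : X) (a : A) :
      tr (x * y) a = tr x (tr y a) ∧ tl (x * y) a = tl x (tr y a) + x * tl y a := by
    apply h.add_inj
    rw [← hxa]
    push_cast
    rw [mul_assoc, hxa, mul_add, hxa, add_assoc]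
  have hAXX (a : A) (x y : X) :
      lh a (x * y) = lh (lh a x) y ∧ rh a (x * y) = rh (lh a x) y + rh a x * y := by
    apply h.add_inj
    rw [← hax]
    push_cast
    rw [← mul_assoc, hax, add_mul, hax, add_assoc]
  have hXAX (x : X) (a : A) (y : X) :
      tr x (lh a y) = lh (tr x a) y ∧
        tl x (lh a y) + x * rh a y = rh (tr x a) y + tl x a * y := by
    apply h.add_inj
    push_cast
    rw [← add_assoc, ← add_assoc, ← hax, ← hxa, ← mul_add, ← add_mul, ← hax, ← hxa, mul_assoc]
  exact ⟨{
    tr := tr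
    tl := tl
    lh := lh
    rh := rh
    rh_mul := fun a b x => (hAAX a b x).2
    tl_mul := fun x a b => (hXAA x a b).2
    rh_tl := fun a x b => (hAXA a x b).2.symm
    tr_mul := fun x y a => (hXXA x y a).1
    lh_mul := fun a x y => (hAXX a x y).1
    tr_lh := fun x a y => (hXAX x a y).1.symm
    mp1 := fun a x y => (hAXX a x y).2.trans (add_comm _ _)
    mp2 := fun a b x => (hAAX a b x).1
    mp3 := fun x a b => (hXAA x a b).1
    mp4 := fun x y a => (hXXA x y a).2
    mp5 := fun a x b => (hAXA a x b).1
    mp6 := fun x a y => (hXAX x a y).2 }, fun x a => ⟨hxa x a, hax a x⟩⟩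
end

section
/- Let E be an algebra that factorizes through subalgebras A and X, and let (A, X, ▷, ◁, ↼, ⇀) be the canonical matched pair of this factorization. Then the map A ⋈ X → E given by (a, x) ↦ a + x is an isomorphism of algebras. -/
/-- If `E` factorizes through subalgebras `A` and `X` and
`(A, X, ▷, ◁, ↼, ⇀)` is the canonical matched pair of this factorization, then the map
`A ⋈ X → E`, `(a, x) ↦ a + x` is an isomorphism of algebras: it is bijective, `K`-linear,
and sends the bicrossed product multiplication to the multiplication of `E`. -/
theorem bicrossedProduct_iso_of_factorization {K E : Type*} [Field K]
    [NonUnitalRing E] [Module K E] [SMulCommClass K E E] [IsScalarTower K E E]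
    (A X : NonUnitalSubalgebra K E) (h : IsComplement A X)
    (mp : MatchedPair K A X) (hmp : IsCanonicalMatchedPair A X mp) :
    Function.Bijective (fun p : A × X => (p.1 : E) + (p.2 : E)) ∧
    (∀ p q : A × X,
      ((bicrossedMul mp p q).1 : E) + ((bicrossedMul mp p q).2 : E) =
        ((p.1 : E) + (p.2 : E)) * ((q.1 : E) + (q.2 : E))) ∧
    (∀ p q : A × X,
      (((p + q).1 : A) : E) + (((p + q).2 : X) : E) =
        ((p.1 : E) + (p.2 : E)) + ((q.1 : E) + (q.2 : E))) ∧
    (∀ (c : K) (p : A × X),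
      (((c • p).1 : A) : E) + (((c • p).2 : X) : E) = c • ((p.1 : E) + (p.2 : E))) := by
  refine ⟨⟨?_, ?_⟩, ?_, ?_, ?_⟩
  · rintro ⟨a, x⟩ ⟨b, y⟩ hab
    replace hab : (a : E) + x = b + y := hab
    have hdiff : (a : E) - b = y - x := by
      rw [sub_eq_sub_iff_add_eq_add, hab, add_comm]
    have hzero : (a : E) - b = 0 :=
      h.2 _ (sub_mem a.2 b.2) (hdiff ▸ sub_mem y.2 x.2)
    have hxy : (y : E) - x = 0 := hdiff ▸ hzero
    exact Prod.ext (Subtype.ext (sub_eq_zero.mp hzero)) (Subtype.ext (sub_eq_zero.mp hxy).symm)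
  · intro e
    obtain ⟨a, ha, x, hx, rfl⟩ := h.1 e
    exact ⟨(⟨a, ha⟩, ⟨x, hx⟩), rfl⟩
  · rintro ⟨a, x⟩ ⟨b, y⟩
    simp only [bicrossedMul, NonUnitalSubalgebra.coe_add, NonUnitalSubalgebra.coe_mul,
      add_mul, mul_add, (hmp x b).1, (hmp y a).2]
    abel
  · intro p q
    simp only [Prod.fst_add, Prod.snd_add, NonUnitalSubalgebra.coe_add]
    abel
  · intro c p
    simp only [Prod.smul_fst, Prod.smul_snd, NonUnitalSubalgebra.coe_smul, smul_add]
end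

section
/- Let (A, X, ▷, ◁, ↼, ⇀) be a matched pair of algebras and r : X → A a deformation map. Then X_r, the vector space X with multiplication x ·_r y = xy + r(x) ⇀ y + x ◁ r(y), is an associative algebra. -/
/-- `r : X → A` is a deformation map of the matched pair `(A, X, ▷, ◁, ↼, ⇀)`:
`r(x)r(y) − r(xy) = r(r(x) ⇀ y + x ◁ r(y)) − r(x) ↼ y − x ▷ r(y)`. -/
def IsDeformationMap {K A X : Type*} [Field K]
    [NonUnitalRing A] [Module K A] [SMulCommClass K A A] [IsScalarTower K A A]
    [NonUnitalRing X] [Module K X] [SMulCommClass K X X] [IsScalarTower K X X]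
    (mp : MatchedPair K A X) (r : X →ₗ[K] A) : Prop :=
  ∀ x y : X, r x * r y - r (x * y) =
    r (mp.rh (r x) y + mp.tl x (r y)) - mp.lh (r x) y - mp.tr x (r y)

/-- The multiplication of the `r`-deformation `X_r` of `X`:
`x ·_r y = xy + r(x) ⇀ y + x ◁ r(y)`. -/
def deformedMul {K A X : Type*} [Field K]
    [NonUnitalRing A] [Module K A] [SMulCommClass K A A] [IsScalarTower K A A]
    [NonUnitalRing X] [Module K X] [SMulCommClass K X X] [IsScalarTower K X X]
    (mp : MatchedPair K A X) (r : X →ₗ[K] A) (x y : X) : X :=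
  x * y + mp.rh (r x) y + mp.tl x (r y)

/-- A deformation map turns the deformed product into the first component of the bicrossed
product of two points of its graph. -/
lemma IsDeformationMap.map_deformedMul {K A X : Type*} [Field K]
    [NonUnitalRing A] [Module K A] [SMulCommClass K A A] [IsScalarTower K A A]
    [NonUnitalRing X] [Module K X] [SMulCommClass K X X] [IsScalarTower K X X]
    {mp : MatchedPair K A X} {r : X →ₗ[K] A} (hr : IsDeformationMap mp r) (x y : X) :
    r (deformedMul mp r x y) = r x * r y + mp.lh (r x) y + mp.tr x (r y) := by
  have h := hr x y
  rw [sub_eq_iff_eq_add] at h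
  rw [h, deformedMul]
  simp only [map_add]
  abel

/-- Associativity of the second component of the bicrossed product. -/
lemma MatchedPair.bicrossedMul_assoc_snd {K A X : Type*} [Field K]
    [NonUnitalRing A] [Module K A] [SMulCommClass K A A] [IsScalarTower K A A]
    [NonUnitalRing X] [Module K X] [SMulCommClass K X X] [IsScalarTower K X X]
    (mp : MatchedPair K A X) (p q s : A × X) :
    (bicrossedMul mp (bicrossedMul mp p q) s).2 =
      (bicrossedMul mp p (bicrossedMul mp q s)).2 := by
  obtain ⟨a, x⟩ := p
  obtain ⟨b, y⟩ := q
  obtain ⟨c, z⟩ := s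
  have h := mp.mp6 x b z
  simp only [bicrossedMul, map_add, LinearMap.add_apply, add_mul, mul_add, mul_assoc,
    mp.rh_mul, mp.tl_mul, mp.rh_tl, mp.mp1, mp.mp4]
  rw [← sub_eq_zero] at h ⊢
  rw [← neg_eq_zero, ← h]
  abel

/-- The graph of a deformation map is closed under the bicrossed product. -/
lemma IsDeformationMap.bicrossedMul_graph {K A X : Type*} [Field K]
    [NonUnitalRing A] [Module K A] [SMulCommClass K A A] [IsScalarTower K A A]
    [NonUnitalRing X] [Module K X] [SMulCommClass K X X] [IsScalarTower K X X]
    {mp : MatchedPair K A X} {r : X →ₗ[K] A} (hr : IsDeformationMap mp r) (x y : X) :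
    bicrossedMul mp (r x, x) (r y, y) = (r (deformedMul mp r x y), deformedMul mp r x y) := by
  rw [hr.map_deformedMul]
  refine Prod.ext rfl ?_
  simp only [bicrossedMul, deformedMul]
  abel

/-- If `(A, X, ▷, ◁, ↼, ⇀)` is a matched pair of algebras and
`r : X → A` is a deformation map, then `X_r` — the vector space `X` with multiplication
`x ·_r y = xy + r(x) ⇀ y + x ◁ r(y)` — is an associative algebra: the multiplication
`·_r` is associative and `K`-bilinear. -/
theorem deformation_isAlgebra {K A X : Type*} [Field K]
    [NonUnitalRing A] [Module K A] [SMulCommClass K A A] [IsScalarTower K A A]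
    [NonUnitalRing X] [Module K X] [SMulCommClass K X X] [IsScalarTower K X X]
    (mp : MatchedPair K A X) (r : X →ₗ[K] A) (hr : IsDeformationMap mp r) :
    (∀ x y z : X,
      deformedMul mp r (deformedMul mp r x y) z = deformedMul mp r x (deformedMul mp r y z)) ∧
    (∀ x y z : X, deformedMul mp r (x + y) z = deformedMul mp r x z + deformedMul mp r y z) ∧
    (∀ x y z : X, deformedMul mp r x (y + z) = deformedMul mp r x y + deformedMul mp r x z) ∧
    (∀ (c : K) (x y : X), deformedMul mp r (c • x) y = c • deformedMul mp r x y) ∧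
    (∀ (c : K) (x y : X), deformedMul mp r x (c • y) = c • deformedMul mp r x y) := by
  refine ⟨fun x y z ↦ ?_, fun x y z ↦ ?_, fun x y z ↦ ?_, fun c x y ↦ ?_, fun c x y ↦ ?_⟩
  · simpa only [hr.bicrossedMul_graph] using
      mp.bicrossedMul_assoc_snd (r x, x) (r y, y) (r z, z)
  · simp only [deformedMul, map_add, LinearMap.add_apply, add_mul]
    abel
  · simp only [deformedMul, map_add, mul_add]
    abel
  · simp only [deformedMul, map_smul, LinearMap.smul_apply, smul_mul_assoc, smul_add]
  · simp only [deformedMul, map_smul, mul_smul_comm, smul_add]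
end

section
/- Let (A, X, ▷, ◁, ↼, ⇀) be a matched pair of algebras, E = A ⋈ X its bicrossed product, and r : X → A a deformation map. Then the set X̃ = {(r(x), x) : x ∈ X} is a subalgebra of E, it is an (A × {0})-complement of E (i.e. E = (A × {0}) + X̃ and (A × {0}) ∩ X̃ = {0}), and the map x ↦ (r(x), x) is an algebra isomorphism from the r-deformation X_r onto X̃. -/
/-- Let `(A, X, ▷, ◁, ↼, ⇀)` be a matched pair of algebras,
`E = A ⋈ X` its bicrossed product and `r : X → A` a deformation map.  Then
`X̃ = {(r(x), x) : x ∈ X}` is a subalgebra of `E` (closed under the bicrossed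
multiplication, addition and scalars), it is an `(A × {0})`-complement of `E`, and
`x ↦ (r(x), x)` is an algebra isomorphism from the `r`-deformation `X_r` onto `X̃`. -/
theorem deformation_gives_complement {K A X : Type*} [Field K]
    [NonUnitalRing A] [Module K A] [SMulCommClass K A A] [IsScalarTower K A A]
    [NonUnitalRing X] [Module K X] [SMulCommClass K X X] [IsScalarTower K X X]
    (mp : MatchedPair K A X) (r : X →ₗ[K] A) (hr : IsDeformationMap mp r) :
    -- `X̃` is a subalgebra of `E = A ⋈ X`
    (∀ x y : X, ∃ z : X, bicrossedMul mp (r x, x) (r y, y) = (r z, z)) ∧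
    (∀ x y : X, ∃ z : X, ((r x, x) : A × X) + (r y, y) = (r z, z)) ∧
    (∀ (c : K) (x : X), ∃ z : X, c • ((r x, x) : A × X) = (r z, z)) ∧
    -- `X̃` is an `(A × {0})`-complement of `E`:  `E = (A × {0}) + X̃` ...
    (∀ p : A × X, ∃ (a : A) (x : X), p = (a, 0) + (r x, x)) ∧
    -- ... and `(A × {0}) ∩ X̃ = {0}`
    (∀ p : A × X, p.2 = 0 → (∃ x : X, p = (r x, x)) → p = 0) ∧
    -- `x ↦ (r(x), x)` is an algebra isomorphism from `X_r` onto `X̃`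
    Function.Injective (fun x : X => ((r x, x) : A × X)) ∧
    (∀ x y : X,
      ((r (deformedMul mp r x y), deformedMul mp r x y) : A × X) =
        bicrossedMul mp (r x, x) (r y, y)) := by
  have hmul (x y : X) : ((r (deformedMul mp r x y), deformedMul mp r x y) : A × X) =
      bicrossedMul mp (r x, x) (r y, y) := by
    have h := hr x y
    simp only [map_add] at h
    simp only [deformedMul, bicrossedMul, map_add, Prod.mk.injEq]
    constructor
    · rw [sub_eq_iff_eq_add.mp h]
      abel
    · abel
  refine ⟨fun x y => ⟨_, (hmul x y).symm⟩, fun x y => ⟨x + y, by simp⟩,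
    fun c x => ⟨c • x, by simp⟩, fun p => ⟨p.1 - r p.2, p.2, by simp⟩, ?_,
    fun x y h => congrArg Prod.snd h, hmul⟩
  rintro _ hp ⟨x, rfl⟩
  obtain rfl : x = 0 := hp
  simp
end

section
/- Let A be a subalgebra of an algebra E, let X be an A-complement of E, and let (A, X, ▷, ◁, ↼, ⇀) be the canonical matched pair associated with the factorization E = A + X. If X̄ is any A-complement of E, then there exists a deformation map r : X → A of this matched pair such that X̄ is isomorphic as an algebra to the r-deformation X_r. -/
/-- If `Y` is an `A`-complement of `E`, an element of `A` is determined by `e : E` and the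
requirement that its sum with `e` lies in `Y`. -/
theorem IsComplement.eq_of_add_mem {K E : Type*} [Field K]
    [NonUnitalRing E] [Module K E] [SMulCommClass K E E] [IsScalarTower K E E]
    {A Y : NonUnitalSubalgebra K E} (hY : IsComplement A Y) {e : E} {a b : A}
    (ha : (a : E) + e ∈ Y) (hb : (b : E) + e ∈ Y) : a = b := by
  have hmem : (a : E) - b ∈ Y := by simpa using sub_mem ha hb
  exact Subtype.ext (sub_eq_zero.mp (hY.2 _ (sub_mem a.2 b.2) hmem))

/-- If `Y` is an `A`-complement of `E`, there is a linear map `r : X → A` whose graph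
`{r x + x}` is contained in `Y`. -/
theorem IsComplement.exists_linearMap_add_mem {K E : Type*} [Field K]
    [NonUnitalRing E] [Module K E] [SMulCommClass K E E] [IsScalarTower K E E]
    {A Y : NonUnitalSubalgebra K E} (hY : IsComplement A Y) (X : NonUnitalSubalgebra K E) :
    ∃ r : X →ₗ[K] A, ∀ x : X, (r x : E) + (x : E) ∈ Y := by
  have hex (x : X) : ∃ a : A, (a : E) + (x : E) ∈ Y := by
    obtain ⟨a, ha, y, hy, hxy⟩ := hY.1 x
    refine ⟨-⟨a, ha⟩, ?_⟩
    simpa [hxy] using hy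
  choose r hr using hex
  refine ⟨{ toFun := r, map_add' := fun x y => ?_, map_smul' := fun c x => ?_ }, hr⟩
  · refine hY.eq_of_add_mem (hr _) ?_
    have hmem := add_mem (hr x) (hr y)
    rwa [add_add_add_comm] at hmem
  · refine hY.eq_of_add_mem (hr _) ?_
    have hmem := SMulMemClass.smul_mem c (hr x)
    rwa [smul_add] at hmem

/-- The product of `r x + x` and `r y + y`, decomposed along `E = A + X`. -/
theorem IsCanonicalMatchedPair.add_mul_add {K E : Type*} [Field K]
    [NonUnitalRing E] [Module K E] [SMulCommClass K E E] [IsScalarTower K E E]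
    {A X : NonUnitalSubalgebra K E} {mp : MatchedPair K A X}
    (hmp : IsCanonicalMatchedPair A X mp) (r : X →ₗ[K] A) (x y : X) :
    ((r x : E) + x) * ((r y : E) + y) =
      ((r x * r y + mp.lh (r x) y + mp.tr x (r y) : A) : E) + ((deformedMul mp r x y : X) : E) := by
  simp only [deformedMul, add_mul, mul_add, (hmp x (r y)).1, (hmp y (r x)).2,
    NonUnitalSubalgebra.coe_add, NonUnitalSubalgebra.coe_mul]
  abel

/-- Let `A` be a subalgebra of `E`, `X` an `A`-complement of `E` and
`(A, X, ▷, ◁, ↼, ⇀)` the canonical matched pair of the factorization `E = A + X`.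
If `X̄` is any `A`-complement of `E`, then there is a deformation map `r : X → A` such
that `X̄` is isomorphic as an algebra to the `r`-deformation `X_r`. -/
theorem complement_iso_deformation {K E : Type*} [Field K]
    [NonUnitalRing E] [Module K E] [SMulCommClass K E E] [IsScalarTower K E E]
    (A X : NonUnitalSubalgebra K E) (h : IsComplement A X)
    (mp : MatchedPair K A X) (hmp : IsCanonicalMatchedPair A X mp)
    (Y : NonUnitalSubalgebra K E) (hY : IsComplement A Y) :
    ∃ r : X →ₗ[K] A, IsDeformationMap mp r ∧
      ∃ f : X ≃ₗ[K] Y, ∀ x y : X, (f (deformedMul mp r x y) : E) = (f x : E) * (f y : E) := by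
  obtain ⟨r, hr⟩ := hY.exists_linearMap_add_mem X
  have hmul (x y : X) : r (deformedMul mp r x y) =
      r x * r y + mp.lh (r x) y + mp.tr x (r y) := by
    refine hY.eq_of_add_mem (hr _) ?_
    rw [← hmp.add_mul_add]
    exact mul_mem (hr x) (hr y)
  refine ⟨r, fun x y => ?_, ?_⟩
  · have hxy := hmul x y
    simp only [deformedMul, map_add] at hxy
    rw [map_add, sub_sub, sub_eq_sub_iff_add_eq_add, ← add_assoc, ← hxy]
    abel
  · let f : X →ₗ[K] Y :=
      { toFun := fun x => ⟨(r x : E) + x, hr x⟩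
        map_add' := fun x y => Subtype.ext <| by
          simp [add_add_add_comm]
        map_smul' := fun c x => Subtype.ext <| by simp }
    have hf (x : X) : (f x : E) = (r x : E) + x := rfl
    have hinj : Function.Injective f := by
      refine (injective_iff_map_eq_zero f).mpr fun x hx => Subtype.ext ?_
      have hx0 : (r x : E) + x = 0 := by rw [← hf, hx]; rfl
      refine h.2 _ ?_ x.2
      rw [eq_neg_of_add_eq_zero_right hx0]
      exact neg_mem (r x).2
    have hsurj : Function.Surjective f := by
      intro y
      obtain ⟨a, ha, x, hx, hy⟩ := h.1 y
      have hrx : r ⟨x, hx⟩ = ⟨a, ha⟩ :=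
        hY.eq_of_add_mem (hr _) (by simp [← hy])
      exact ⟨⟨x, hx⟩, Subtype.ext (by rw [hf, hrx, hy])⟩
    have hbij : Function.Bijective f := ⟨hinj, hsurj⟩
    refine ⟨LinearEquiv.ofBijective f hbij, fun x y => ?_⟩
    simp only [LinearEquiv.ofBijective_apply, hf, hmul, hmp.add_mul_add]
end

section
/- Let (A, X, ▷, ◁, ↼, ⇀) be a matched pair of algebras. The relation ∼ on the set of deformation maps of this matched pair, defined by: r ∼ R iff there exists a linear automorphism σ of X with σ(xy) − σ(x)σ(y) = σ(x) ◁ R(σ(y)) + R(σ(x)) ⇀ σ(y) − σ(x ◁ r(y)) − σ(r(x) ⇀ y) for all x, y ∈ X, is an equivalence relation. -/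
/-- Two deformation maps `r, R : X → A` are equivalent (`r ∼ R`) if there is a linear
automorphism `σ` of `X` with
`σ(xy) − σ(x)σ(y) = σ(x) ◁ R(σ(y)) + R(σ(x)) ⇀ σ(y) − σ(x ◁ r(y)) − σ(r(x) ⇀ y)`
for all `x, y ∈ X`. -/
def DefMapEquiv {K A X : Type*} [Field K]
    [NonUnitalRing A] [Module K A] [SMulCommClass K A A] [IsScalarTower K A A]
    [NonUnitalRing X] [Module K X] [SMulCommClass K X X] [IsScalarTower K X X]
    (mp : MatchedPair K A X) (r R : X →ₗ[K] A) : Prop :=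
  ∃ σ : X ≃ₗ[K] X, ∀ x y : X,
    σ (x * y) - σ x * σ y =
      mp.tl (σ x) (R (σ y)) + mp.rh (R (σ x)) (σ y)
        - σ (mp.tl x (r y)) - σ (mp.rh (r x) y)

/-- `r ∼ R` holds exactly when the deformed products on `X` given by `r` and `R` are isomorphic. -/
theorem defMapEquiv_iff_map_deformedMul {K A X : Type*} [Field K]
    [NonUnitalRing A] [Module K A] [SMulCommClass K A A] [IsScalarTower K A A]
    [NonUnitalRing X] [Module K X] [SMulCommClass K X X] [IsScalarTower K X X]
    (mp : MatchedPair K A X) (r R : X →ₗ[K] A) :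
    DefMapEquiv mp r R ↔ ∃ σ : X ≃ₗ[K] X, ∀ x y : X,
      σ (deformedMul mp r x y) = deformedMul mp R (σ x) (σ y) := by
  refine exists_congr fun σ => forall₂_congr fun x y => ?_
  simp only [deformedMul, map_add]
  constructor <;> intro h <;> rw [← sub_eq_zero] at h ⊢ <;> rw [← h] <;> abel

/-- For a matched pair of algebras `(A, X, ▷, ◁, ↼, ⇀)`, the relation
`∼` on the set of deformation maps of the matched pair is an equivalence relation. -/
theorem defMapEquiv_equivalence {K A X : Type*} [Field K]
    [NonUnitalRing A] [Module K A] [SMulCommClass K A A] [IsScalarTower K A A]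
    [NonUnitalRing X] [Module K X] [SMulCommClass K X X] [IsScalarTower K X X]
    (mp : MatchedPair K A X) :
    Equivalence (fun r R : {r : X →ₗ[K] A // IsDeformationMap mp r} =>
      DefMapEquiv mp r.1 R.1) := by
  simp only [defMapEquiv_iff_map_deformedMul]
  refine ⟨fun _ => ⟨.refl K X, fun _ _ => rfl⟩, ?_, ?_⟩
  · rintro _ _ ⟨σ, hσ⟩
    exact ⟨σ.symm, fun x y => by simp [σ.symm_apply_eq, hσ]⟩
  · rintro _ _ _ ⟨σ, hσ⟩ ⟨τ, hτ⟩
    exact ⟨σ.trans τ, fun x y => by simp [hσ, hτ]⟩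
end

section
/- Let A ⊂ M_3(K) be the subalgebra of 3×3 matrices whose third row is zero. Then there exist at least four pairwise non-isomorphic A-complements of M_3(K); in particular the factorization index [M_3(K) : A]^f is at least 4. Concretely, the subalgebra X of matrices supported in the third row is an A-complement, and the three 3-dimensional algebras X_1, X_2, X_3 on the basis {e_1, e_2, e_3} with nonzero products X_1: e_3e_1 = e_1, e_3e_2 = e_2e_3 = e_2, e_3e_3 = e_3; X_2: e_1e_3 = e_3e_1 = e_1, e_2e_3 = e_3e_2 = e_2, e_3e_3 = e_3; X_3: e_1e_1 = e_2, e_1e_3 = e_3e_1 = e_1, e_2e_3 = e_3e_2 = e_2, e_3e_3 = e_3, are each isomorphic to an A-complement of M_3(K), and X, X_1, X_2, X_3 are pairwise non-isomorphic as K-algebras. -/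
/-- The subalgebra of `3 × 3` matrices whose third row is zero. -/
def rowZero3 (K : Type*) [Field K] :
    NonUnitalSubalgebra K (Matrix (Fin 3) (Fin 3) K) where
  carrier := {M | ∀ j : Fin 3, M 2 j = 0}
  add_mem' := by
    intro a b ha hb
    simp only [Set.mem_setOf_eq] at ha hb ⊢
    intro j; simp [Matrix.add_apply, ha j, hb j]
  zero_mem' := by intro j; rfl
  smul_mem' := by
    intro c M hM
    simp only [Set.mem_setOf_eq] at hM ⊢
    intro j; simp [Matrix.smul_apply, hM j]
  mul_mem' := by
    intro M N hM hN
    simp only [Set.mem_setOf_eq] at hM hN ⊢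
    intro j; simp [Matrix.mul_apply, Fin.sum_univ_three, hM]

/-- The subalgebra of `3 × 3` matrices supported in the third row. -/
def thirdRow3 (K : Type*) [Field K] :
    NonUnitalSubalgebra K (Matrix (Fin 3) (Fin 3) K) where
  carrier := {M | ∀ j : Fin 3, M 0 j = 0 ∧ M 1 j = 0}
  add_mem' := by
    intro a b ha hb
    simp only [Set.mem_setOf_eq] at ha hb ⊢
    intro j; exact ⟨by simp [Matrix.add_apply, (ha j).1, (hb j).1],
      by simp [Matrix.add_apply, (ha j).2, (hb j).2]⟩
  zero_mem' := by intro j; exact ⟨rfl, rfl⟩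
  smul_mem' := by
    intro c M hM
    simp only [Set.mem_setOf_eq] at hM ⊢
    intro j; exact ⟨by simp [Matrix.smul_apply, (hM j).1],
      by simp [Matrix.smul_apply, (hM j).2]⟩
  mul_mem' := by
    intro M N hM hN
    simp only [Set.mem_setOf_eq] at hM hN ⊢
    intro j
    constructor <;>
      simp [Matrix.mul_apply, Fin.sum_univ_three, (hM 0).1, (hM 1).1, (hM 2).1,
        (hM 0).2, (hM 1).2, (hM 2).2]

/-- The multiplication of the `3`-dimensional algebra `X₁` with basis `e₁, e₂, e₃`
(coordinates `0, 1, 2`) and nonzero products `e₃e₁ = e₁`, `e₃e₂ = e₂e₃ = e₂`,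
`e₃e₃ = e₃`. -/
def mulX1 {K : Type*} [Field K] (u v : Fin 3 → K) : Fin 3 → K :=
  ![u 2 * v 0, u 2 * v 1 + u 1 * v 2, u 2 * v 2]

/-- The multiplication of the `3`-dimensional algebra `X₂` with nonzero products
`e₁e₃ = e₃e₁ = e₁`, `e₂e₃ = e₃e₂ = e₂`, `e₃e₃ = e₃`. -/
def mulX2 {K : Type*} [Field K] (u v : Fin 3 → K) : Fin 3 → K :=
  ![u 0 * v 2 + u 2 * v 0, u 1 * v 2 + u 2 * v 1, u 2 * v 2]

/-- The multiplication of the `3`-dimensional algebra `X₃` with nonzero products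
`e₁e₁ = e₂`, `e₁e₃ = e₃e₁ = e₁`, `e₂e₃ = e₃e₂ = e₂`, `e₃e₃ = e₃`. -/
def mulX3 {K : Type*} [Field K] (u v : Fin 3 → K) : Fin 3 → K :=
  ![u 0 * v 2 + u 2 * v 0, u 0 * v 0 + u 1 * v 2 + u 2 * v 1, u 2 * v 2]

/-- A linear representation `M` of a multiplication `m` on `K³` by `3 × 3` matrices such that the
third row of `M a` is `a` realizes `m` as a complement of the matrices with zero third row. -/
theorem exists_isComplement_rowZero3 {K : Type*} [Field K]
    (m : (Fin 3 → K) → (Fin 3 → K) → Fin 3 → K)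
    (M : (Fin 3 → K) →ₗ[K] Matrix (Fin 3) (Fin 3) K)
    (hrow : ∀ a, M a 2 = a) (hmul : ∀ a b, M a * M b = M (m a b)) :
    ∃ Y : NonUnitalSubalgebra K (Matrix (Fin 3) (Fin 3) K),
      IsComplement (rowZero3 K) Y ∧
      ∃ f : Y ≃ₗ[K] (Fin 3 → K), ∀ u v : Y, f (u * v) = m (f u) (f v) := by
  let Y : NonUnitalSubalgebra K (Matrix (Fin 3) (Fin 3) K) :=
    { M.range with
      mul_mem' := by
        rintro _ _ ⟨a, rfl⟩ ⟨b, rfl⟩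
        exact ⟨m a b, (hmul a b).symm⟩ }
  have hinj : Function.Injective M := fun a b h => by
    rw [← hrow a, h, hrow b]
  let g : (Fin 3 → K) ≃ₗ[K] Y := LinearEquiv.ofInjective M hinj
  have hg : ∀ a, (g a : Matrix (Fin 3) (Fin 3) K) = M a := fun _ => rfl
  refine ⟨Y, ⟨fun e => ⟨e - M (e 2), fun j => ?_, M (e 2), ⟨e 2, rfl⟩, by simp⟩, ?_⟩,
    g.symm, fun u v => ?_⟩
  · rw [Matrix.sub_apply, hrow, sub_self]
  · rintro _ h ⟨a, rfl⟩
    have ha : a = 0 := by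
      rw [← hrow a]
      exact funext h
    rw [ha, map_zero]
  · obtain ⟨a, rfl⟩ := g.surjective u
    obtain ⟨b, rfl⟩ := g.surjective v
    rw [LinearEquiv.symm_apply_eq, LinearEquiv.symm_apply_apply, LinearEquiv.symm_apply_apply]
    exact Subtype.ext (hmul a b)

theorem exists_isComplement_mulX1 (K : Type*) [Field K] :
    ∃ Y : NonUnitalSubalgebra K (Matrix (Fin 3) (Fin 3) K),
      IsComplement (rowZero3 K) Y ∧
      ∃ f : Y ≃ₗ[K] (Fin 3 → K), ∀ u v : Y, f (u * v) = mulX1 (f u) (f v) := by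
  refine exists_isComplement_rowZero3 mulX1
    { toFun := fun a => !![0, 0, 0; 0, a 2, 0; a 0, a 1, a 2]
      map_add' := fun a b => by ext i j; fin_cases i <;> fin_cases j <;> simp
      map_smul' := fun c a => by ext i j; fin_cases i <;> fin_cases j <;> simp }
    (fun a => by ext j; fin_cases j <;> rfl) (fun a b => ?_)
  ext i j
  fin_cases i <;> fin_cases j <;>
    simp [mulX1, Matrix.mul_apply, Fin.sum_univ_three]
  ring

theorem exists_isComplement_mulX2 (K : Type*) [Field K] :
    ∃ Y : NonUnitalSubalgebra K (Matrix (Fin 3) (Fin 3) K),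
      IsComplement (rowZero3 K) Y ∧
      ∃ f : Y ≃ₗ[K] (Fin 3 → K), ∀ u v : Y, f (u * v) = mulX2 (f u) (f v) := by
  refine exists_isComplement_rowZero3 mulX2
    { toFun := fun a => !![a 2, 0, 0; 0, a 2, 0; a 0, a 1, a 2]
      map_add' := fun a b => by ext i j; fin_cases i <;> fin_cases j <;> simp
      map_smul' := fun c a => by ext i j; fin_cases i <;> fin_cases j <;> simp }
    (fun a => by ext j; fin_cases j <;> rfl) (fun a b => ?_)
  ext i j
  fin_cases i <;> fin_cases j <;>
    simp [mulX2, Matrix.mul_apply, Fin.sum_univ_three]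

theorem exists_isComplement_mulX3 (K : Type*) [Field K] :
    ∃ Y : NonUnitalSubalgebra K (Matrix (Fin 3) (Fin 3) K),
      IsComplement (rowZero3 K) Y ∧
      ∃ f : Y ≃ₗ[K] (Fin 3 → K), ∀ u v : Y, f (u * v) = mulX3 (f u) (f v) := by
  refine exists_isComplement_rowZero3 mulX3
    { toFun := fun a => !![a 2, a 0, 0; 0, a 2, 0; a 0, a 1, a 2]
      map_add' := fun a b => by ext i j; fin_cases i <;> fin_cases j <;> simp
      map_smul' := fun c a => by ext i j; fin_cases i <;> fin_cases j <;> simp }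
    (fun a => by ext j; fin_cases j <;> rfl) (fun a b => ?_)
  ext i j
  fin_cases i <;> fin_cases j <;>
    simp [mulX3, Matrix.mul_apply, Fin.sum_univ_three]
  ring

theorem isComplement_rowZero3_thirdRow3 (K : Type*) [Field K] :
    IsComplement (rowZero3 K) (thirdRow3 K) := by
  refine ⟨fun e => ⟨!![e 0 0, e 0 1, e 0 2; e 1 0, e 1 1, e 1 2; 0, 0, 0], fun j => ?_,
    !![0, 0, 0; 0, 0, 0; e 2 0, e 2 1, e 2 2], fun j => ?_, ?_⟩, fun e hA hX => ?_⟩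
  · fin_cases j <;> rfl
  · fin_cases j <;> exact ⟨rfl, rfl⟩
  · ext i j
    fin_cases i <;> fin_cases j <;> simp
  · ext i j
    fin_cases i
    exacts [(hX j).1, (hX j).2, hA j]

/-- Multiplication on the left acts by scalars in the algebra of matrices supported in the third
row. -/
theorem thirdRow3_mul_eq_smul {K : Type*} [Field K] (u v : thirdRow3 K) :
    u * v = (u : Matrix (Fin 3) (Fin 3) K) 2 2 • v := by
  obtain ⟨u, hu⟩ := u
  obtain ⟨v, hv⟩ := v
  refine Subtype.ext (Matrix.ext fun i j => ?_)
  change (u * v) i j = u 2 2 * v i j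
  rw [Matrix.mul_apply, Fin.sum_univ_three, (hv j).1, (hv j).2]
  fin_cases i <;> simp [(hu 2).1, (hu 2).2, (hv j).1, (hv j).2]

/-- A multiplication isomorphic to that of `thirdRow3 K` multiplies by scalars on the left. -/
theorem exists_smul_of_thirdRow3_equiv {K V : Type*} [Field K] [AddCommGroup V] [Module K V]
    {m : V → V → V} (f : thirdRow3 K ≃ₗ[K] V)
    (hf : ∀ u v : thirdRow3 K, f (u * v) = m (f u) (f v)) (x y : V) :
    ∃ c : K, m x y = c • y := by
  refine ⟨(f.symm x : Matrix (Fin 3) (Fin 3) K) 2 2, ?_⟩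
  have h := hf (f.symm x) (f.symm y)
  rw [thirdRow3_mul_eq_smul, map_smul] at h
  simpa using h.symm

theorem mulX2_comm {K : Type*} [Field K] (u v : Fin 3 → K) : mulX2 u v = mulX2 v u := by
  ext i
  fin_cases i <;> simp [mulX2] <;> ring

theorem mulX3_comm {K : Type*} [Field K] (u v : Fin 3 → K) : mulX3 u v = mulX3 v u := by
  ext i
  fin_cases i <;> simp [mulX3] <;> ring

/-- `mulX1` is not isomorphic to a commutative multiplication. -/
theorem not_injective_of_mulX1_hom_comm {K V : Type*} [Field K] {m : V → V → V}
    (hm : ∀ u v, m u v = m v u) (f : (Fin 3 → K) → V)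
    (hf : ∀ u v, f (mulX1 u v) = m (f u) (f v)) : ¬ Function.Injective f := by
  intro hinj
  have h : mulX1 ![0, 0, 1] ![1, 0, 0] = mulX1 ![1, 0, 0] ![0, 0, (1 : K)] :=
    hinj (by rw [hf, hf, hm])
  simpa [mulX1] using congrFun h 0

/-- The algebra `X₂` has no element of cube zero and nonzero square. -/
theorem mulX2_self_eq_zero {K : Type*} [Field K] {u : Fin 3 → K}
    (h : mulX2 u (mulX2 u u) = 0) : mulX2 u u = 0 := by
  have h2 : u 2 = 0 := by simpa [mulX2] using congrFun h 2
  ext i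
  fin_cases i <;> simp [mulX2, h2]

/-- Let `A ⊂ M₃(K)` be the subalgebra of matrices with zero third
row.  There are at least four pairwise non-isomorphic `A`-complements of `M₃(K)`, so
`[M₃(K) : A]^f ≥ 4`: the subalgebra `X` of matrices supported in the third row is an
`A`-complement; each of the algebras `X₁, X₂, X₃` is isomorphic to an `A`-complement;
and `X, X₁, X₂, X₃` are pairwise non-isomorphic. -/
theorem factorization_index_M3_ge_four (K : Type*) [Field K] :
    IsComplement (rowZero3 K) (thirdRow3 K) ∧
    (∃ Y : NonUnitalSubalgebra K (Matrix (Fin 3) (Fin 3) K),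
      IsComplement (rowZero3 K) Y ∧
      ∃ f : Y ≃ₗ[K] (Fin 3 → K), ∀ u v : Y, f (u * v) = mulX1 (f u) (f v)) ∧
    (∃ Y : NonUnitalSubalgebra K (Matrix (Fin 3) (Fin 3) K),
      IsComplement (rowZero3 K) Y ∧
      ∃ f : Y ≃ₗ[K] (Fin 3 → K), ∀ u v : Y, f (u * v) = mulX2 (f u) (f v)) ∧
    (∃ Y : NonUnitalSubalgebra K (Matrix (Fin 3) (Fin 3) K),
      IsComplement (rowZero3 K) Y ∧
      ∃ f : Y ≃ₗ[K] (Fin 3 → K), ∀ u v : Y, f (u * v) = mulX3 (f u) (f v)) ∧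
    ¬ (∃ f : thirdRow3 K ≃ₗ[K] (Fin 3 → K), ∀ u v : thirdRow3 K,
        f (u * v) = mulX1 (f u) (f v)) ∧
    ¬ (∃ f : thirdRow3 K ≃ₗ[K] (Fin 3 → K), ∀ u v : thirdRow3 K,
        f (u * v) = mulX2 (f u) (f v)) ∧
    ¬ (∃ f : thirdRow3 K ≃ₗ[K] (Fin 3 → K), ∀ u v : thirdRow3 K,
        f (u * v) = mulX3 (f u) (f v)) ∧
    ¬ (∃ f : (Fin 3 → K) ≃ₗ[K] (Fin 3 → K), ∀ u v : Fin 3 → K,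
        f (mulX1 u v) = mulX2 (f u) (f v)) ∧
    ¬ (∃ f : (Fin 3 → K) ≃ₗ[K] (Fin 3 → K), ∀ u v : Fin 3 → K,
        f (mulX1 u v) = mulX3 (f u) (f v)) ∧
    ¬ (∃ f : (Fin 3 → K) ≃ₗ[K] (Fin 3 → K), ∀ u v : Fin 3 → K,
        f (mulX2 u v) = mulX3 (f u) (f v)) := by
  refine ⟨isComplement_rowZero3_thirdRow3 K, exists_isComplement_mulX1 K,
    exists_isComplement_mulX2 K, exists_isComplement_mulX3 K, ?_, ?_, ?_,
    fun ⟨f, hf⟩ => not_injective_of_mulX1_hom_comm mulX2_comm f hf f.injective,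
    fun ⟨f, hf⟩ => not_injective_of_mulX1_hom_comm mulX3_comm f hf f.injective, ?_⟩
  · rintro ⟨f, hf⟩
    obtain ⟨c, hc⟩ := exists_smul_of_thirdRow3_equiv f hf ![0, 1, 0] ![0, 0, 1]
    simpa [mulX1] using congrFun hc 1
  · rintro ⟨f, hf⟩
    obtain ⟨c, hc⟩ := exists_smul_of_thirdRow3_equiv f hf ![1, 0, 0] ![0, 0, 1]
    simpa [mulX2] using congrFun hc 0
  · rintro ⟨f, hf⟩
    obtain ⟨c, hc⟩ := exists_smul_of_thirdRow3_equiv f hf ![1, 0, 0] ![0, 0, 1]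
    simpa [mulX3] using congrFun hc 0
  · rintro ⟨f, hf⟩
    obtain ⟨u, hu⟩ := f.surjective ![1, 0, 0]
    have hcube : mulX2 u (mulX2 u u) = 0 := by
      refine f.injective ?_
      rw [hf, hf, hu, map_zero]
      ext i
      fin_cases i <;> simp [mulX3]
    have hsq : mulX3 ![1, 0, 0] ![1, 0, (0 : K)] = 0 := by
      rw [← hu, ← hf, mulX2_self_eq_zero hcube, map_zero]
    simpa [mulX3] using congrFun hsq 1
end
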